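/- In any execution of the multi-writer auditable register implementation (Algorithm 1), consider a READ operation by process p_i that starts with local variable lsr = x0 and, in the first iteration of its repeat loop, reads x1 from M.widx. Then for every index x with x0 < x < x1 and every sequence win stored in SLR[x], i is not in READERS(win); in particular, the READ cannot have received help in any such sliding register. -/

import Mathlib

/-!
# An operational model of Algorithm 1 (multi-writer auditable register)

The algorithm implements an `n`-writer `m`-reader auditable register from an
unbounded array `SLR[-1,0,1,...]` of `(m+n)`-sliding registers, a max register
`M` storing a triple `(widx, ridx, auditset)` (ordered by its first field,
modelled here as an atomic object), and an array `H[1..m]` of single-writer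
registers.  Each line of the pseudo-code is a step; readers, writers and
auditors are modelled by explicit program counters, and executions are
alternating sequences of configurations and labelled steps starting from the
initial configuration.
-/

namespace Alg1

/-- Values stored in the auditable register. -/
abbrev Val := ℕ

/-- Entries of the sliding registers: `w`-tuples `(w, j, v, h)` posted by
    writers (with `h` a helping set of readers) and reader identifiers. -/
inductive Entry (m n : ℕ) where
  | w (j : Fin n) (v : Val) (h : Finset (Fin m))
  | r (i : Fin m)

variable {m n : ℕ}

def Entry.isW : Entry m n → Bool
  | .w _ _ _ => true
  | .r _ => false

/-- Does the window contain a `w`-tuple? -/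
def hasW (win : List (Entry m n)) : Bool := win.any Entry.isW

/-- The first `w`-tuple in a window, if any. -/
def firstW : List (Entry m n) → Option (Fin n × Val × Finset (Fin m))
  | [] => none
  | .w j v h :: _ => some (j, v, h)
  | .r _ :: rest => firstW rest

/-- `getValue`: the value of the first `w`-tuple of a window (default `0`). -/
def wval (win : List (Entry m n)) : Val := ((firstW win).map fun t => t.2.1).getD 0

/-- Reader identifiers that precede every `w`-tuple of a window. -/
def preW : List (Entry m n) → Finset (Fin m)
  | [] => ∅
  | .w _ _ _ :: _ => ∅
  | .r i :: rest => insert i (preW rest)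

/-- `READERS(win)`: readers preceding every `w`-tuple, together with the
    helping set of the first `w`-tuple, if any. -/
def readersOf (win : List (Entry m n)) : Finset (Fin m) :=
  preW win ∪ ((firstW win).map fun t => t.2.2).getD ∅

/-- Content of the max register `M`: a triple `(widx, ridx, auditset)`,
    ordered by the first field. -/
structure MVal (m : ℕ) where
  widx : ℤ
  ridx : Fin m → ℤ
  aud : Finset (Fin m × Val)

/-- Semantics of `writeMax` on `M`. -/
def wmax (old new : MVal m) : MVal m := if old.widx < new.widx then new else old

/-- The triple written to `M` after reading window `win` from `SLR[x]`:
    `(x+1, ridx[j ∈ READERS(win)] := x, auditset ∪ {(j, lv) : j ∈ READERS(win)})`. -/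
def mArg (mc : MVal m) (win : List (Entry m n)) (x : ℤ) (lv : Val) : MVal m where
  widx := x + 1
  ridx := fun j => if j ∈ readersOf win then x else mc.ridx j
  aud := mc.aud ∪ (readersOf win).image fun j => (j, lv)

/-- Write to a `k`-sliding register: append, keeping the last `k` entries. -/
def slide (k : ℕ) (l : List (Entry m n)) (e : Entry m n) : List (Entry m n) :=
  let l' := l ++ [e]
  l'.drop (l'.length - k)

/-- Program counter of a reader (one state per line of the pseudo-code). -/
inductive RPC where
  | idle
  | precheck   -- read `SLR[lsr]` (line `rd_last_wd`)
  | preM       -- read `M` (line `new_write`)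
  | preHelp    -- `writeMax` on `M` (line `rd_help_M1`)
  | loopM      -- read `M` at the head of the repeat loop (line `rd_M`)
  | helpVal    -- found help: read `SLR[lsr-1]` (`getValue`, line `rd_return_help`)
  | annH       -- write `H[i] := lsr` (line `rd_annouce_att`)
  | wSLR       -- write `i` to `SLR[lsr]` (line `rd_do_att`)
  | rSLR       -- read `SLR[lsr]` (line `rd_do_att`)
  | gVal       -- read `SLR[lsr-1]` (`getValue`, line `rd_val`)
  | helpChk    -- help the pending write to complete (line `rd_help_M2`)
  | loopEnd    -- evaluate the until condition (line `rd_att_success`)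
  | retNow     -- return `lval`

structure RState (m n : ℕ) where
  lsr : ℤ
  lval : Val
  mc : MVal m
  win : List (Entry m n)
  it : ℕ          -- number of iterations of the repeat loop of the current READ
  pc : RPC

/-- Program counter of a writer. -/
inductive WPC where
  | idle
  | readM    -- read `M` (line `w_read_M`)
  | scanH    -- read `H[k]` (line `w_att`)
  | scanS    -- read `SLR[a_k]` (line `w_help_wd`)
  | post     -- write the `w`-tuple to `SLR[widx]` (line `w_write_SLR`)
  | postR    -- read `SLR[widx]`
  | postV    -- read `SLR[widx-1]` (`getValue`)
  | postM    -- `writeMax` on `M` (line `w_write_M`)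
  | wret     -- return

structure WState (m n : ℕ) where
  v : Val
  mc : MVal m
  toHelp : Finset (Fin m)
  k : ℕ
  a : ℤ
  win : List (Entry m n)
  val : Val
  pc : WPC

/-- Program counter of an auditor. -/
inductive APC where
  | idle
  | aM       -- read `M` (line `adt_read_M`)
  | aR       -- read `SLR[widx]` (line `adt_val`)
  | aV       -- read `SLR[widx-1]` (`getValue`, line `adt_val`)
  | aret     -- return the audit set

structure AState (m n : ℕ) where
  mc : MVal m
  win : List (Entry m n)
  val : Val
  pc : APC

/-- Processes: `m` readers, `n` writers, and arbitrarily many auditors. -/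
inductive Proc (m n : ℕ) where
  | rdr (i : Fin m)
  | wtr (j : Fin n)
  | adt (a : ℕ)
  deriving DecidableEq

/-- A configuration: shared memory plus the local state of every process. -/
structure Config (m n : ℕ) where
  slr : ℤ → List (Entry m n)
  M : MVal m
  H : Fin m → ℤ
  rst : Fin m → RState m n
  wst : Fin n → WState m n
  ast : ℕ → AState m n

/-- Step labels: invocations and responses of high-level operations, and
    primitive operations applied to the base objects. -/
inductive Lbl (m n : ℕ) where
  | invRead (i : Fin m)
  | respRead (i : Fin m) (v : Val)
  | invWrite (j : Fin n) (v : Val)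
  | respWrite (j : Fin n)
  | invAudit (a : ℕ)
  | respAudit (a : ℕ) (A : Finset (Fin m × Val))
  | slrRead (p : Proc m n) (x : ℤ) (win : List (Entry m n))
  | slrWrite (p : Proc m n) (x : ℤ) (e : Entry m n)
  | mRead (p : Proc m n) (v : MVal m)
  | mWrite (p : Proc m n) (v : MVal m)
  | hRead (j : Fin n) (k : Fin m) (a : ℤ)
  | hWrite (i : Fin m) (x : ℤ)
  | tau (p : Proc m n)

def upR (c : Config m n) (i : Fin m) (s : RState m n) : Config m n :=
  { c with rst := Function.update c.rst i s }

def upW (c : Config m n) (j : Fin n) (s : WState m n) : Config m n :=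
  { c with wst := Function.update c.wst j s }

def upA (c : Config m n) (a : ℕ) (s : AState m n) : Config m n :=
  { c with ast := Function.update c.ast a s }

/-- The transition relation of Algorithm 1. -/
def Step (c : Config m n) (l : Lbl m n) (c' : Config m n) : Prop :=
  match l with
  | .invRead i =>
      let s := c.rst i
      s.pc = .idle ∧
      c' = upR c i { s with it := 0, pc := if 0 ≤ s.lsr then RPC.precheck else RPC.loopM }
  | .respRead i v =>
      let s := c.rst i
      s.pc = .retNow ∧ v = s.lval ∧ c' = upR c i { s with pc := .idle }
  | .invWrite j v =>
      let s := c.wst j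
      s.pc = .idle ∧ c' = upW c j { s with v := v, pc := .readM }
  | .respWrite j =>
      let s := c.wst j
      s.pc = .wret ∧ c' = upW c j { s with pc := .idle }
  | .invAudit a =>
      let s := c.ast a
      s.pc = .idle ∧ c' = upA c a { s with pc := .aM }
  | .respAudit a A =>
      let s := c.ast a
      s.pc = .aret ∧
      A = s.mc.aud ∪ (readersOf s.win).image (fun j => (j, s.val)) ∧
      c' = upA c a { s with pc := .idle }
  | .slrRead p x win =>
      win = c.slr x ∧
      (match p with
       | .rdr i =>
          let s := c.rst i
          (s.pc = .precheck ∧ x = s.lsr ∧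
             c' = upR c i { s with win := win, pc := if hasW win then RPC.preM else RPC.retNow }) ∨
          (s.pc = .helpVal ∧ x = s.lsr - 1 ∧
             c' = upR c i { s with lval := wval win, pc := .retNow }) ∨
          (s.pc = .rSLR ∧ x = s.lsr ∧
             c' = upR c i { s with win := win, pc := .gVal }) ∨
          (s.pc = .gVal ∧ x = s.lsr - 1 ∧
             c' = upR c i { s with lval := wval win, pc := .helpChk })
       | .wtr j =>
          let s := c.wst j
          (s.pc = .scanS ∧ x = s.a ∧
             (∃ hk : s.k < m,
               c' = upW c j { s with toHelp := if (⟨s.k, hk⟩ : Fin m) ∈ readersOf win then s.toHelp else insert (⟨s.k, hk⟩ : Fin m) s.toHelp, k := s.k + 1, pc := .scanH })) ∨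
          (s.pc = .postR ∧ x = s.mc.widx ∧
             c' = upW c j { s with win := win, pc := .postV }) ∨
          (s.pc = .postV ∧ x = s.mc.widx - 1 ∧
             c' = upW c j { s with val := wval win, pc := .postM })
       | .adt a =>
          let s := c.ast a
          (s.pc = .aR ∧ x = s.mc.widx ∧
             c' = upA c a { s with win := win, pc := .aV }) ∨
          (s.pc = .aV ∧ x = s.mc.widx - 1 ∧
             c' = upA c a { s with val := wval win, pc := .aret }))
  | .slrWrite p x e =>
      (match p with
       | .rdr i =>
          let s := c.rst i
          s.pc = .wSLR ∧ x = s.lsr ∧ e = .r i ∧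
          c' = { upR c i { s with pc := .rSLR } with
                 slr := Function.update c.slr x (slide (m + n) (c.slr x) e) }
       | .wtr j =>
          let s := c.wst j
          s.pc = .post ∧ x = s.mc.widx ∧ e = .w j s.v s.toHelp ∧
          c' = { upW c j { s with pc := .postR } with
                 slr := Function.update c.slr x (slide (m + n) (c.slr x) e) }
       | .adt _ => False)
  | .mRead p v =>
      v = c.M ∧
      (match p with
       | .rdr i =>
          let s := c.rst i
          (s.pc = .preM ∧
             c' = upR c i { s with mc := v, pc := if v.widx = s.lsr then RPC.preHelp else RPC.loopM }) ∨
          (s.pc = .loopM ∧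
             c' = upR c i (if s.lsr < v.ridx i then
                { s with mc := v, it := s.it + 1, lsr := v.ridx i, pc := .helpVal }
              else
                { s with mc := v, it := s.it + 1, lsr := v.widx, pc := .annH }))
       | .wtr j =>
          let s := c.wst j
          s.pc = .readM ∧
          c' = upW c j { s with mc := v, toHelp := ∅, k := 0, pc := .scanH }
       | .adt a =>
          let s := c.ast a
          s.pc = .aM ∧ c' = upA c a { s with mc := v, pc := .aR })
  | .mWrite p v =>
      (match p with
       | .rdr i =>
          let s := c.rst i
          (s.pc = .preHelp ∧ v = mArg s.mc s.win s.lsr s.lval ∧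
             c' = { upR c i { s with pc := .loopM } with M := wmax c.M v }) ∨
          (s.pc = .helpChk ∧ hasW s.win = true ∧ v = mArg s.mc s.win s.lsr s.lval ∧
             c' = { upR c i { s with pc := .loopEnd } with M := wmax c.M v })
       | .wtr j =>
          let s := c.wst j
          s.pc = .postM ∧ v = mArg s.mc s.win s.mc.widx s.val ∧
          c' = { upW c j { s with pc := .wret } with M := wmax c.M v }
       | .adt _ => False)
  | .hRead j k a =>
      let s := c.wst j
      s.pc = .scanH ∧ (k : ℕ) = s.k ∧ a = c.H k ∧
      c' = upW c j (if s.mc.ridx k < a then { s with a := a, pc := .scanS }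
                    else { s with k := s.k + 1 })
  | .hWrite i x =>
      let s := c.rst i
      s.pc = .annH ∧ x = s.lsr ∧
      c' = { upR c i { s with pc := .wSLR } with H := Function.update c.H i x }
  | .tau p =>
      match p with
      | .rdr i =>
          let s := c.rst i
          (s.pc = .helpChk ∧ hasW s.win = false ∧
             c' = upR c i { s with pc := .loopEnd }) ∨
          (s.pc = .loopEnd ∧
             c' = upR c i { s with pc := if i ∈ readersOf s.win then RPC.retNow else RPC.loopM })
      | .wtr j =>
          let s := c.wst j
          s.pc = .scanH ∧ s.k = m ∧ c' = upW c j { s with pc := .post }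
      | .adt _ => False

/-- The initial configuration: `SLR[-1]` holds `(w, j₀, v₀, ∅)`, all other
    sliding registers are empty, `M = (0, [-1,…,-1], ∅)`, `H = [-1,…,-1]`,
    and every process is idle (readers start with `lsr = -1`). -/
def init (m n : ℕ) (v0 : Val) (j0 : Fin n) : Config m n where
  slr := fun x => if x = -1 then [.w j0 v0 ∅] else []
  M := ⟨0, fun _ => -1, ∅⟩
  H := fun _ => -1
  rst := fun _ => ⟨-1, v0, ⟨0, fun _ => -1, ∅⟩, [], 0, .idle⟩
  wst := fun _ => ⟨v0, ⟨0, fun _ => -1, ∅⟩, ∅, 0, -1, [], v0, .idle⟩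
  ast := fun _ => ⟨⟨0, fun _ => -1, ∅⟩, [], v0, .idle⟩

/-- A finite execution of Algorithm 1: configurations `cfg 0, …, cfg len`
    connected by labelled steps. -/
structure Exec (m n : ℕ) (v0 : Val) (j0 : Fin n) where
  len : ℕ
  cfg : ℕ → Config m n
  lbl : ℕ → Lbl m n
  h0 : cfg 0 = init m n v0 j0
  hstep : ∀ t, t < len → Step (cfg t) (lbl t) (cfg (t + 1))

variable {v0 : Val} {j0 : Fin n}

/-! ### Derived notions -/

/-- The process performing a step. -/
def procOf : Lbl m n → Proc m n
  | .invRead i => .rdr i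
  | .respRead i _ => .rdr i
  | .invWrite j _ => .wtr j
  | .respWrite j => .wtr j
  | .invAudit a => .adt a
  | .respAudit a _ => .adt a
  | .slrRead p _ _ => p
  | .slrWrite p _ _ => p
  | .mRead p _ => p
  | .mWrite p _ => p
  | .hRead j _ _ => .wtr j
  | .hWrite i _ => .rdr i
  | .tau p => p

/-- The label writes a `w`-tuple to `SLR[x]`. -/
def isWWrite (l : Lbl m n) (x : ℤ) : Prop :=
  ∃ p j v h, l = .slrWrite p x (.w j v h)

/-- Step `t` is the first write of a `w`-tuple to `SLR[x]` in the execution. -/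
def FirstWWriteAt (E : Exec m n v0 j0) (x : ℤ) (t : ℕ) : Prop :=
  t < E.len ∧ isWWrite (E.lbl t) x ∧ ∀ t', t' < t → ¬ isWWrite (E.lbl t') x

/-- Step `t` changes `M.widx` from `ℓ - 1` to `ℓ`. -/
def WidxChangeAt (E : Exec m n v0 j0) (ℓ : ℤ) (t : ℕ) : Prop :=
  t < E.len ∧ (∃ p v, E.lbl t = .mWrite p v) ∧
  (E.cfg t).M.widx = ℓ - 1 ∧ (E.cfg (t + 1)).M.widx = ℓ

/-- `x` is the largest index of a sliding register containing a `w`-tuple. -/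
def WIDXis (c : Config m n) (x : ℤ) : Prop :=
  hasW (c.slr x) = true ∧ ∀ y : ℤ, x < y → hasW (c.slr y) = false

/-- Configuration in region `D_ℓ`: `M.widx = ℓ = WIDX + 1`. -/
def inD (c : Config m n) (ℓ : ℤ) : Prop := c.M.widx = ℓ ∧ WIDXis c (ℓ - 1)

/-- Configuration in region `E_ℓ`: `M.widx = ℓ = WIDX`. -/
def inE (c : Config m n) (ℓ : ℤ) : Prop := c.M.widx = ℓ ∧ WIDXis c ℓ

/-! ### Classification of operations, and linearizations -/

/-- Classification of the operations of Algorithm 1. -/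
inductive Kind where
  | silentR | directR | helpedR | visibleW | hiddenW | defA | nondefA
  deriving DecidableEq

/-- Rank used by the linearization rules `R1`–`R4` within a block of
    operations with the same index. -/
def rank : Kind → ℕ
  | .silentR => 0
  | .directR => 0
  | .nondefA => 0
  | .helpedR => 1
  | .defA => 2
  | .hiddenW => 3
  | .visibleW => 4

def Kind.isRead : Kind → Prop
  | .silentR => True | .directR => True | .helpedR => True
  | _ => False

def Kind.isWrite : Kind → Prop
  | .visibleW => True | .hiddenW => True
  | _ => False

def Kind.isAudit : Kind → Prop
  | .defA => True | .nondefA => True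
  | _ => False

/-- The data of a classified operation: its process, invocation step, optional
    response step, kind, associated sliding-register index `idx`, its
    characteristic step `key` on `SLR[idx]` (used by the linearization rules),
    its value (return value of a READ / input of a WRITE) and, for an AUDIT,
    the returned audit set. -/
structure OpData (m n : ℕ) where
  proc : Proc m n
  inv : ℕ
  resp : Option ℕ
  kind : Kind
  idx : ℤ
  key : ℕ
  val : Val
  aset : Finset (Fin m × Val)

/-- The label is a response event of process `p`. -/
def isRespOf (l : Lbl m n) (p : Proc m n) : Prop :=
  (∃ i v, p = .rdr i ∧ l = .respRead i v) ∨
  (∃ j, p = .wtr j ∧ l = .respWrite j) ∨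
  (∃ a A, p = .adt a ∧ l = .respAudit a A)

/-- `resp` is the matching response of the operation of `p` invoked at `a`
    (or the operation is pending if `resp = none`). -/
def RespMatch (E : Exec m n v0 j0) (p : Proc m n) (a : ℕ) : Option ℕ → Prop
  | some b => a < b ∧ b < E.len ∧ isRespOf (E.lbl b) p ∧
      ∀ t, a < t → t < b → ¬ isRespOf (E.lbl t) p
  | none => ∀ t, a < t → t < E.len → ¬ isRespOf (E.lbl t) p

/-- `x` is the smallest index `> x0` of a sliding register in which reader `i`
    is recorded (evaluated in the final configuration). -/
def minRecIdx (E : Exec m n v0 j0) (i : Fin m) (x0 x : ℤ) : Prop :=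
  x0 < x ∧ i ∈ readersOf ((E.cfg E.len).slr x) ∧
    ∀ y : ℤ, x0 < y → y < x → i ∉ readersOf ((E.cfg E.len).slr y)

/-- The return value of a classified READ: the actual response if the READ is
    complete; for a pending classified READ (completed in `H'`), the value of
    the first `w`-tuple of `SLR[idx-1]`. -/
def ReadValOK (E : Exec m n v0 j0) (o : OpData m n) (i : Fin m) : Prop :=
  match o.resp with
  | some b => E.lbl b = .respRead i o.val
  | none => o.val = wval ((E.cfg E.len).slr (o.idx - 1))

/-- `o` describes a classified operation of the execution `E`. -/
def IsOp (E : Exec m n v0 j0) (o : OpData m n) : Prop :=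
  o.inv < E.len ∧ RespMatch E o.proc o.inv o.resp ∧
  match o.kind with
  | .silentR =>
      ∃ i b win, o.proc = .rdr i ∧ o.resp = some b ∧
        E.lbl o.inv = .invRead i ∧
        (∃ t', t' < o.inv ∧ E.lbl t' = .invRead i) ∧
        o.idx = ((E.cfg o.inv).rst i).lsr ∧
        o.inv < o.key ∧ o.key < b ∧
        E.lbl o.key = .slrRead (.rdr i) o.idx win ∧
        ((E.cfg o.key).rst i).pc = .precheck ∧
        hasW win = false ∧
        E.lbl b = .respRead i o.val ∧
        o.aset = ∅
  | .directR =>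
      ∃ i, o.proc = .rdr i ∧ E.lbl o.inv = .invRead i ∧
        minRecIdx E i ((E.cfg o.inv).rst i).lsr o.idx ∧
        i ∈ preW ((E.cfg E.len).slr o.idx) ∧
        o.inv < o.key ∧ o.key < E.len ∧
        E.lbl o.key = .slrWrite (.rdr i) o.idx (.r i) ∧
        (∀ b, o.resp = some b → o.key < b) ∧
        ReadValOK E o i ∧ o.aset = ∅
  | .helpedR =>
      ∃ i, o.proc = .rdr i ∧ E.lbl o.inv = .invRead i ∧
        minRecIdx E i ((E.cfg o.inv).rst i).lsr o.idx ∧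
        i ∉ preW ((E.cfg E.len).slr o.idx) ∧
        o.key = o.inv ∧ ReadValOK E o i ∧ o.aset = ∅
  | .visibleW =>
      ∃ j h, o.proc = .wtr j ∧ E.lbl o.inv = .invWrite j o.val ∧
        o.inv < o.key ∧ o.key < E.len ∧
        E.lbl o.key = .slrWrite (.wtr j) o.idx (.w j o.val h) ∧
        (∀ b, o.resp = some b → o.key < b) ∧
        firstW ((E.cfg E.len).slr o.idx) = some (j, o.val, h) ∧
        o.aset = ∅
  | .hiddenW =>
      ∃ j h, o.proc = .wtr j ∧ E.lbl o.inv = .invWrite j o.val ∧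
        o.inv < o.key ∧ o.key < E.len ∧
        E.lbl o.key = .slrWrite (.wtr j) o.idx (.w j o.val h) ∧
        (∀ b, o.resp = some b → o.key < b) ∧
        firstW ((E.cfg E.len).slr o.idx) ≠ some (j, o.val, h) ∧
        o.aset = ∅
  | .defA =>
      ∃ a b tM mv win, o.proc = .adt a ∧ o.resp = some b ∧
        E.lbl o.inv = .invAudit a ∧
        o.inv < tM ∧ tM < o.key ∧ o.key < b ∧
        E.lbl tM = .mRead (.adt a) mv ∧ ((E.cfg tM).ast a).pc = .aM ∧
        o.idx = mv.widx ∧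
        E.lbl o.key = .slrRead (.adt a) o.idx win ∧
        ((E.cfg o.key).ast a).pc = .aR ∧
        hasW win = true ∧
        E.lbl b = .respAudit a o.aset ∧ o.val = 0
  | .nondefA =>
      ∃ a b tM mv win, o.proc = .adt a ∧ o.resp = some b ∧
        E.lbl o.inv = .invAudit a ∧
        o.inv < tM ∧ tM < o.key ∧ o.key < b ∧
        E.lbl tM = .mRead (.adt a) mv ∧ ((E.cfg tM).ast a).pc = .aM ∧
        o.idx = mv.widx ∧
        E.lbl o.key = .slrRead (.adt a) o.idx win ∧
        ((E.cfg o.key).ast a).pc = .aR ∧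
        hasW win = false ∧
        E.lbl b = .respAudit a o.aset ∧ o.val = 0

/-- `o` terminates (its response event occurs) before `o'` starts. -/
def EndsBefore (o o' : OpData m n) : Prop :=
  ∃ b, o.resp = some b ∧ b < o'.inv

/-- `lt` is a linearization of the classified operations of `E` obeying the
    rules `R0`–`R4`: a strict total order on classified operations, ordering
    operations by increasing `idx` (`R0`); within the same `idx`, first
    silent READs, direct READs and non-definitive AUDITs ordered by their
    characteristic step on `SLR[idx]` (`R1`), then helped READs in arbitrary
    order followed by the definitive AUDITs ordered by their read of
    `SLR[idx]` (`R2`), then the hidden WRITEs ordered by their write to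
    `SLR[idx]` (`R3`), and the visible WRITE last (`R4`). -/
def LinOK (E : Exec m n v0 j0) (lt : OpData m n → OpData m n → Prop) : Prop :=
  (∀ o, IsOp E o → ¬ lt o o) ∧
  (∀ o₁ o₂ o₃, IsOp E o₁ → IsOp E o₂ → IsOp E o₃ →
      lt o₁ o₂ → lt o₂ o₃ → lt o₁ o₃) ∧
  (∀ o₁ o₂, IsOp E o₁ → IsOp E o₂ → o₁ ≠ o₂ → lt o₁ o₂ ∨ lt o₂ o₁) ∧
  (∀ o₁ o₂, IsOp E o₁ → IsOp E o₂ → o₁.idx < o₂.idx → lt o₁ o₂) ∧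
  (∀ o₁ o₂, IsOp E o₁ → IsOp E o₂ → o₁.idx = o₂.idx →
      rank o₁.kind < rank o₂.kind → lt o₁ o₂) ∧
  (∀ o₁ o₂, IsOp E o₁ → IsOp E o₂ → o₁.idx = o₂.idx →
      rank o₁.kind = rank o₂.kind → o₁.kind ≠ .helpedR →
      o₁.key < o₂.key → lt o₁ o₂)

/-! ### Auxiliary lemmas on windows -/

theorem hasW_mono {l l' : List (Entry m n)} (h : l <+: l') (hw : hasW l = true) :
    hasW l' = true := by
  obtain ⟨t, rfl⟩ := h
  simp only [hasW, List.any_append, Bool.or_eq_true] at *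
  exact Or.inl hw

theorem hasW_of_mem {l : List (Entry m n)} {j v h} (hm : Entry.w j v h ∈ l) :
    hasW l = true := by
  simp only [hasW, List.any_eq_true]
  exact ⟨_, hm, rfl⟩

theorem readersOf_nil : readersOf ([] : List (Entry m n)) = ∅ := by
  simp [readersOf, preW, firstW]

theorem readersOf_w (j v h) (l : List (Entry m n)) : readersOf (.w j v h :: l) = h := by
  simp [readersOf, preW, firstW]

theorem readersOf_r (i) (l : List (Entry m n)) :
    readersOf (.r i :: l) = insert i (readersOf l) := by
  simp [readersOf, preW, firstW]

theorem readersOf_append (l t : List (Entry m n)) :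
    (hasW l = true → readersOf (l ++ t) = readersOf l) ∧ readersOf l ⊆ readersOf (l ++ t) := by
  induction l with
  | nil => simp [hasW, readersOf_nil]
  | cons e l ih =>
    cases e with
    | w j v h => simp [readersOf_w]
    | r i =>
      simp only [List.cons_append, readersOf_r]
      refine ⟨fun hw => ?_, Finset.insert_subset_insert _ ih.2⟩
      rw [ih.1]
      simpa [hasW, Entry.isW] using hw

theorem readersOf_mono {l l' : List (Entry m n)} (h : l <+: l') {i} (hi : i ∈ readersOf l) :
    i ∈ readersOf l' := by
  obtain ⟨t, rfl⟩ := h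
  exact (readersOf_append l t).2 hi

theorem readersOf_fix {l l' : List (Entry m n)} (h : l <+: l') (hw : hasW l = true) :
    readersOf l' = readersOf l := by
  obtain ⟨t, rfl⟩ := h
  exact (readersOf_append l t).1 hw

theorem mem_readersOf_of_noW {l : List (Entry m n)} {i} (hm : Entry.r i ∈ l)
    (hw : hasW l = false) : i ∈ readersOf l := by
  induction l with
  | nil => simp at hm
  | cons e l ih =>
    cases e with
    | w j v h => simp [hasW, Entry.isW] at hw
    | r k =>
      rw [readersOf_r]
      simp only [List.mem_cons, Entry.r.injEq] at hm
      rcases hm with rfl | hm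
      · simp
      · refine Finset.mem_insert_of_mem (ih hm ?_)
        simpa [hasW, Entry.isW] using hw

theorem mem_of_mem_readersOf {l : List (Entry m n)} {i} (hi : i ∈ readersOf l) :
    Entry.r i ∈ l ∨ ∃ j v h, Entry.w j v h ∈ l ∧ i ∈ h := by
  induction l with
  | nil => simp [readersOf_nil] at hi
  | cons e l ih =>
    cases e with
    | w j v h =>
      rw [readersOf_w] at hi
      exact Or.inr ⟨j, v, h, by simp, hi⟩
    | r k =>
      rw [readersOf_r, Finset.mem_insert] at hi
      rcases hi with rfl | hi
      · simp
      · rcases ih hi with h | ⟨j, v, h, h1, h2⟩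
        · exact Or.inl (List.mem_cons_of_mem _ h)
        · exact Or.inr ⟨j, v, h, List.mem_cons_of_mem _ h1, h2⟩

/-- The process that posted an entry. -/
def Entry.pid : Entry m n → Fin m ⊕ Fin n
  | .w j _ _ => .inr j
  | .r i => .inl i

theorem slide_eq {l : List (Entry m n)} {e : Entry m n} (h : ((l ++ [e]).map Entry.pid).Nodup) :
    slide (m + n) l e = l ++ [e] := by
  have h1 := h.length_le_card
  simp only [List.length_map, Fintype.card_sum, Fintype.card_fin] at h1
  simp only [slide]
  rw [Nat.sub_eq_zero_of_le h1, List.drop_zero]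

theorem nodup_r {l : List (Entry m n)} {i} (h : (l.map Entry.pid).Nodup) (hi : Entry.r i ∉ l) :
    ((l ++ [Entry.r i]).map Entry.pid).Nodup := by
  rw [List.map_append, List.nodup_append]
  refine ⟨h, by simp, ?_⟩
  intro a ha b hb
  simp only [List.map_cons, List.map_nil, List.mem_singleton, Entry.pid] at hb
  subst hb
  rintro rfl
  obtain ⟨e, he, hp⟩ := List.mem_map.1 ha
  cases e with
  | w j v h => simp [Entry.pid] at hp
  | r k =>
    simp only [Entry.pid, Sum.inl.injEq] at hp
    subst hp
    exact hi he

theorem nodup_w {l : List (Entry m n)} {j v hs} (h : (l.map Entry.pid).Nodup)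
    (hi : ∀ v h, Entry.w j v h ∉ l) :
    ((l ++ [Entry.w j v hs]).map Entry.pid).Nodup := by
  rw [List.map_append, List.nodup_append]
  refine ⟨h, by simp, ?_⟩
  intro a ha b hb
  simp only [List.map_cons, List.map_nil, List.mem_singleton, Entry.pid] at hb
  subst hb
  rintro rfl
  obtain ⟨e, he, hp⟩ := List.mem_map.1 ha
  cases e with
  | r k => simp [Entry.pid] at hp
  | w k v h =>
    simp only [Entry.pid, Sum.inr.injEq] at hp
    subst hp
    exact hi _ _ he

/-! ### Invariants -/

/-- A triple is a correct summary of the sliding registers below its `widx`. -/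
structure MOK (slr : ℤ → List (Entry m n)) (v : MVal m) : Prop where
  w0 : 0 ≤ v.widx
  rlo : ∀ k, -1 ≤ v.ridx k
  rhi : ∀ k, v.ridx k < v.widx
  rin : ∀ k, 0 ≤ v.ridx k → k ∈ readersOf (slr (v.ridx k))
  has : ∀ y, 0 ≤ y → y < v.widx → hasW (slr y) = true
  rmax : ∀ y, 0 ≤ y → y < v.widx → ∀ k, k ∈ readersOf (slr y) → y ≤ v.ridx k

theorem MOK.ext {slr slr' : ℤ → List (Entry m n)} {v : MVal m} (h : MOK slr v)
    (he : ∀ x, slr x <+: slr' x) : MOK slr' v where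
  w0 := h.w0
  rlo := h.rlo
  rhi := h.rhi
  rin k hk := readersOf_mono (he _) (h.rin k hk)
  has y h0 h1 := hasW_mono (he _) (h.has y h0 h1)
  rmax y h0 h1 k hk := by
    rw [readersOf_fix (he y) (h.has y h0 h1)] at hk
    exact h.rmax y h0 h1 k hk

theorem MOK.mArg {slr : ℤ → List (Entry m n)} {v : MVal m} (h : MOK slr v) {win : List (Entry m n)}
    {x : ℤ} (hx : v.widx = x) (hp : win <+: slr x) (hw : hasW win = true) (lv : Val) :
    MOK slr (mArg v win x lv) := by
  have hf := readersOf_fix hp hw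
  constructor
  · have := h.w0; simp only [Alg1.mArg]; omega
  · intro k
    have := h.w0
    have := h.rlo k
    simp only [Alg1.mArg]; split <;> omega
  · intro k
    have := h.rhi k
    simp only [Alg1.mArg]; split <;> omega
  · intro k
    simp only [Alg1.mArg]
    split
    · intro _; rw [hf]; assumption
    · exact h.rin k
  · intro y h0 h1
    simp only [Alg1.mArg] at h1
    rcases eq_or_ne y x with rfl | hne
    · exact hasW_mono hp hw
    · exact h.has y h0 (by omega)
  · intro y h0 h1 k hk
    simp only [Alg1.mArg] at h1 ⊢
    split
    · omega
    · rename_i hn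
      rcases eq_or_ne y x with rfl | hne
      · rw [hf] at hk; exact absurd hk hn
      · exact h.rmax y h0 (by omega) k hk

theorem MOK.wmax {slr : ℤ → List (Entry m n)} {v w : MVal m} (h : MOK slr v) (h' : MOK slr w) :
    MOK slr (wmax v w) := by
  unfold Alg1.wmax; split <;> assumption

theorem wmax_le (v w : MVal m) : v.widx ≤ (wmax v w).widx ∧ w.widx ≤ (wmax v w).widx := by
  unfold wmax; split <;> constructor <;> omega

/-- Reader `i` (with current `lsr = l`) may be recorded in the helping set of a tuple of `SLR[x]`. -/
def HelpOK (slr : ℤ → List (Entry m n)) (l : ℤ) (i : Fin m) (x : ℤ) : Prop :=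
  (∀ y, 0 ≤ y → y < x → hasW (slr y) = true) ∧
  ∃ a, 0 ≤ a ∧ a ≤ l ∧ ∀ y, 0 ≤ y → y < x → i ∈ readersOf (slr y) → y < a

theorem HelpOK.ext {slr slr' : ℤ → List (Entry m n)} {l l' : ℤ} {i : Fin m} {x : ℤ}
    (h : HelpOK slr l i x) (he : ∀ x, slr x <+: slr' x) (hl : l ≤ l') : HelpOK slr' l' i x := by
  obtain ⟨h1, a, h2, h3, h4⟩ := h
  refine ⟨fun y h0 h5 => hasW_mono (he _) (h1 y h0 h5), a, h2, by omega, fun y h0 h5 hi => ?_⟩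
  rw [readersOf_fix (he y) (h1 y h0 h5)] at hi
  exact h4 y h0 h5 hi

/-- Invariant of reader `i`. -/
structure RInv (slr : ℤ → List (Entry m n)) (Mw Hi : ℤ) (i : Fin m) (s : RState m n) : Prop where
  lsr_ge : -1 ≤ s.lsr
  lsr_le : s.lsr ≤ Mw
  H_le : Hi ≤ s.lsr
  mok : MOK slr s.mc
  own : ∀ x, Entry.r i ∈ slr x → x ≤ s.lsr
  fresh : s.pc = .annH ∨ s.pc = .wSLR → ∀ x, Entry.r i ∈ slr x → x < s.lsr
  settled : s.pc = .idle ∨ s.pc = .precheck ∨ s.pc = .preM ∨ s.pc = .preHelp ∨ s.pc = .retNow ∨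
    s.pc = .helpVal ∨ (s.pc = .loopM ∧ s.it = 0) → s.lsr = -1 ∨ i ∈ readersOf (slr s.lsr)
  itpos : s.pc = .annH ∨ s.pc = .wSLR ∨ s.pc = .rSLR ∨ s.pc = .gVal ∨ s.pc = .helpChk ∨
    s.pc = .loopEnd → s.it ≠ 0
  loop : s.pc = .loopM → s.lsr < Mw
  wpre : s.pc = .preM ∨ s.pc = .preHelp ∨ s.pc = .gVal ∨ s.pc = .helpChk ∨ s.pc = .loopEnd →
    s.win <+: slr s.lsr
  whas : s.pc = .preM ∨ s.pc = .preHelp → hasW s.win = true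
  wown : s.pc = .gVal ∨ s.pc = .helpChk ∨ s.pc = .loopEnd → Entry.r i ∈ s.win
  rown : s.pc = .rSLR → Entry.r i ∈ slr s.lsr
  mceq : s.pc = .preHelp ∨ s.pc = .annH ∨ s.pc = .wSLR ∨ s.pc = .rSLR ∨ s.pc = .gVal ∨
    s.pc = .helpChk ∨ s.pc = .loopEnd → s.mc.widx = s.lsr
  fin : s.pc = .loopEnd → hasW s.win = true → s.lsr < Mw

theorem RInv.ext {slr slr' : ℤ → List (Entry m n)} {Mw Mw' Hi : ℤ} {i : Fin m} {s : RState m n}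
    (h : RInv slr Mw Hi i s) (he : ∀ x, slr x <+: slr' x) (hM : Mw ≤ Mw')
    (hn : ∀ x, Entry.r i ∈ slr' x → Entry.r i ∈ slr x) : RInv slr' Mw' Hi i s where
  lsr_ge := h.lsr_ge
  lsr_le := h.lsr_le.trans hM
  H_le := h.H_le
  mok := h.mok.ext he
  own x hx := h.own x (hn x hx)
  fresh hp x hx := h.fresh hp x (hn x hx)
  settled hp := (h.settled hp).imp id (readersOf_mono (he _))
  itpos := h.itpos
  loop hp := (h.loop hp).trans_le hM
  wpre hp := (h.wpre hp).trans (he _)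
  whas := h.whas
  wown := h.wown
  rown hp := (he _).subset (h.rown hp)
  mceq := h.mceq
  fin hp hw := (h.fin hp hw).trans_le hM

/-- Invariant of writer `j`. -/
structure WInv (slr : ℤ → List (Entry m n)) (Mw : ℤ) (lsr : Fin m → ℤ) (j : Fin n)
    (s : WState m n) : Prop where
  mok : MOK slr s.mc
  mle : s.mc.widx ≤ Mw
  own : ∀ x v h, Entry.w j v h ∈ slr x →
    x < Mw ∨ ((s.pc = .postR ∨ s.pc = .postV ∨ s.pc = .postM) ∧ x = s.mc.widx)
  fresh : s.pc = .scanH ∨ s.pc = .scanS ∨ s.pc = .post →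
    ∀ x v h, Entry.w j v h ∈ slr x → x < s.mc.widx
  help : s.pc = .scanH ∨ s.pc = .scanS ∨ s.pc = .post →
    ∀ i ∈ s.toHelp, HelpOK slr (lsr i) i s.mc.widx
  scan : s.pc = .scanS → ∀ hk : s.k < m, s.mc.ridx ⟨s.k, hk⟩ < s.a ∧ s.a ≤ lsr ⟨s.k, hk⟩
  pR : s.pc = .postR → hasW (slr s.mc.widx) = true
  pV : s.pc = .postV ∨ s.pc = .postM → s.win <+: slr s.mc.widx ∧ hasW s.win = true

theorem WInv.ext {slr slr' : ℤ → List (Entry m n)} {Mw Mw' : ℤ} {lsr lsr' : Fin m → ℤ} {j : Fin n}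
    {s : WState m n} (h : WInv slr Mw lsr j s) (he : ∀ x, slr x <+: slr' x) (hM : Mw ≤ Mw')
    (hl : ∀ i, lsr i ≤ lsr' i)
    (hn : ∀ x v h, Entry.w j v h ∈ slr' x → Entry.w j v h ∈ slr x) : WInv slr' Mw' lsr' j s where
  mok := h.mok.ext he
  mle := h.mle.trans hM
  own x v hs hx := (h.own x v hs (hn x v hs hx)).imp (fun h => h.trans_le hM) id
  fresh hp x v hs hx := h.fresh hp x v hs (hn x v hs hx)
  help hp i hi := (h.help hp i hi).ext he (hl i)
  scan hp hk := ⟨(h.scan hp hk).1, (h.scan hp hk).2.trans (hl _)⟩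
  pR hp := hasW_mono (he _) (h.pR hp)
  pV hp := ⟨(h.pV hp).1.trans (he _), (h.pV hp).2⟩

/-- The global invariant. -/
structure Inv (c : Config m n) : Prop where
  nd : ∀ x, ((c.slr x).map Entry.pid).Nodup
  mok : MOK c.slr c.M
  r : ∀ i, RInv c.slr c.M.widx (c.H i) i (c.rst i)
  w : ∀ j, WInv c.slr c.M.widx (fun i => (c.rst i).lsr) j (c.wst j)
  hp : ∀ x j v h, Entry.w j v h ∈ c.slr x → ∀ i ∈ h, HelpOK c.slr (c.rst i).lsr i x

theorem inv_start (m n : ℕ) (v0 : Val) (j0 : Fin n) : Inv (init m n v0 j0) := by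
  have hm : MOK (init m n v0 j0).slr ⟨0, fun _ => -1, ∅⟩ := by
    constructor <;> simp <;> intros <;> omega
  have hr : ∀ x i, Entry.r i ∉ (init m n v0 j0).slr x := by
    intro x i; simp only [init]; split <;> simp
  have hw : ∀ x j v h, Entry.w j v h ∈ (init m n v0 j0).slr x → x = -1 ∧ h = ∅ := by
    intro x j v h; simp only [init]; split <;> simp_all
  refine ⟨?_, hm, ?_, ?_, ?_⟩
  · intro x; simp only [init]; split <;> simp
  · intro i
    constructor <;> first | exact hm | (intro x hx; exact absurd hx (hr x i)) | simp [init]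
  · intro j
    constructor <;> first
      | exact hm
      | (intro x v h hx; have := (hw _ _ _ _ hx).1; left; simp [init]; omega)
      | simp [init]
  · intro x j v h hx i hi
    rw [(hw _ _ _ _ hx).2] at hi
    simp at hi

theorem reader_step {c : Config m n} (hI : Inv c) {i : Fin m} {s' : RState m n}
    {slr' : ℤ → List (Entry m n)} {M' : MVal m} {H' : Fin m → ℤ}
    (he : ∀ x, c.slr x <+: slr' x)
    (hn : ∀ x e, e ∈ slr' x → e ∈ c.slr x ∨ e = .r i)
    (hnd : ∀ x, ((slr' x).map Entry.pid).Nodup)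
    (hM : MOK slr' M') (hMw : c.M.widx ≤ M'.widx)
    (hH : ∀ k, k ≠ i → H' k = c.H k)
    (hl : (c.rst i).lsr ≤ s'.lsr)
    (hs : RInv slr' M'.widx (H' i) i s') :
    Inv ⟨slr', M', H', Function.update c.rst i s', c.wst, c.ast⟩ := by
  have hlsr : ∀ k, (c.rst k).lsr ≤ (Function.update c.rst i s' k).lsr := by
    intro k
    rcases eq_or_ne k i with rfl | hk
    · simpa using hl
    · simp [hk]
  have hnw : ∀ x j v h, Entry.w j v h ∈ slr' x → Entry.w j v h ∈ c.slr x := by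
    intro x j v h hx
    simpa using hn _ _ hx
  refine ⟨hnd, hM, ?_, ?_, ?_⟩
  · intro k
    rcases eq_or_ne k i with rfl | hk
    · simpa using hs
    · simp only [Function.update_of_ne hk, hH k hk]
      refine (hI.r k).ext he hMw ?_
      intro x hx
      simpa [hk] using hn _ _ hx
  · intro j
    exact (hI.w j).ext he hMw hlsr (fun x => hnw x j)
  · intro x j v h hx k hk
    exact (hI.hp x j v h (hnw _ _ _ _ hx) k hk).ext he (hlsr k)

theorem reader_local {c : Config m n} (hI : Inv c) {i : Fin m} {s' : RState m n}
    (hl : (c.rst i).lsr ≤ s'.lsr)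
    (hs : RInv c.slr c.M.widx (c.H i) i s') : Inv (upR c i s') :=
  reader_step hI (fun _ => List.prefix_rfl) (fun _ _ h => Or.inl h) hI.nd hI.mok le_rfl
    (fun _ _ => rfl) hl hs

theorem reader_M {c : Config m n} (hI : Inv c) {i : Fin m} {s' : RState m n} {v : MVal m}
    (hv : MOK c.slr v)
    (hl : (c.rst i).lsr ≤ s'.lsr)
    (hs : RInv c.slr (wmax c.M v).widx (c.H i) i s') :
    Inv { upR c i s' with M := wmax c.M v } :=
  reader_step hI (fun _ => List.prefix_rfl) (fun _ _ h => Or.inl h) hI.nd (hI.mok.wmax hv)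
    (wmax_le _ _).1 (fun _ _ => rfl) hl hs

theorem writer_step {c : Config m n} (hI : Inv c) {j : Fin n} {s' : WState m n}
    {slr' : ℤ → List (Entry m n)} {M' : MVal m}
    (he : ∀ x, c.slr x <+: slr' x)
    (hn : ∀ x e, e ∈ slr' x → e ∈ c.slr x ∨
      ∃ v h, e = .w j v h ∧ ∀ i ∈ h, HelpOK c.slr (c.rst i).lsr i x)
    (hnd : ∀ x, ((slr' x).map Entry.pid).Nodup)
    (hM : MOK slr' M') (hMw : c.M.widx ≤ M'.widx)
    (hs : WInv slr' M'.widx (fun i => (c.rst i).lsr) j s') :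
    Inv ⟨slr', M', c.H, c.rst, Function.update c.wst j s', c.ast⟩ := by
  refine ⟨hnd, hM, ?_, ?_, ?_⟩
  · intro k
    refine (hI.r k).ext he hMw ?_
    intro x hx
    simpa using hn _ _ hx
  · intro k
    rcases eq_or_ne k j with rfl | hk
    · simpa using hs
    · simp only [Function.update_of_ne hk]
      refine (hI.w k).ext he hMw (fun _ => le_rfl) ?_
      intro x v h hx
      simpa [hk] using hn _ _ hx
  · intro x k v h hx i hi
    rcases hn _ _ hx with h1 | ⟨v', h', h1, h2⟩
    · exact (hI.hp x k v h h1 i hi).ext he le_rfl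
    · simp only [Entry.w.injEq] at h1
      obtain ⟨-, -, rfl⟩ := h1
      exact (h2 i hi).ext he le_rfl

theorem writer_local {c : Config m n} (hI : Inv c) {j : Fin n} {s' : WState m n}
    (hs : WInv c.slr c.M.widx (fun i => (c.rst i).lsr) j s') : Inv (upW c j s') :=
  writer_step hI (fun _ => List.prefix_rfl) (fun _ _ h => Or.inl h) hI.nd hI.mok le_rfl hs

theorem inv_upA {c : Config m n} (hI : Inv c) (a s) : Inv (upA c a s) :=
  ⟨hI.nd, hI.mok, hI.r, hI.w, hI.hp⟩

theorem upd_prefix (slr : ℤ → List (Entry m n)) (x : ℤ) (e : Entry m n) (y : ℤ) :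
    slr y <+: Function.update slr x (slr x ++ [e]) y := by
  rcases eq_or_ne y x with rfl | h
  · simp
  · simp [h]

theorem upd_mem {slr : ℤ → List (Entry m n)} {x : ℤ} {e : Entry m n} {y : ℤ} {e' : Entry m n}
    (h : e' ∈ Function.update slr x (slr x ++ [e]) y) : e' ∈ slr y ∨ (y = x ∧ e' = e) := by
  rcases eq_or_ne y x with rfl | h'
  · simpa using h
  · simp [h'] at h; exact Or.inl h

/-- Every step preserves the invariant and extends the sliding registers. -/
theorem inv_step {c c' : Config m n} {l : Lbl m n} (hI : Inv c) (hs : Step c l c') :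
    Inv c' ∧ ∀ x, c.slr x <+: c'.slr x := by
  have rf : ∀ x, c.slr x <+: c.slr x := fun _ => List.prefix_rfl
  cases l with
  | invRead i =>
    obtain ⟨hpc, rfl⟩ := hs
    have R := hI.r i
    refine ⟨reader_local hI le_rfl ?_, rf⟩
    have h0 := hI.mok.w0
    have h1 := R.settled (Or.inl hpc)
    by_cases hl : 0 ≤ (c.rst i).lsr
    · constructor <;> simp only [hl, if_true] <;>
        first | exact R.lsr_ge | exact R.lsr_le | exact R.H_le | exact R.mok | exact R.own | simp [h1]
    · constructor <;> simp only [hl, if_false] <;>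
        first | exact R.lsr_ge | exact R.lsr_le | exact R.H_le | exact R.mok | exact R.own | simp [h1] | skip
      omega
  | respRead i v =>
    obtain ⟨hpc, -, rfl⟩ := hs
    have R := hI.r i
    refine ⟨reader_local hI le_rfl ?_, rf⟩
    have h1 := R.settled (by simp [hpc])
    constructor <;>
        first | exact R.lsr_ge | exact R.lsr_le | exact R.H_le | exact R.mok | exact R.own | simp [h1]
  | invWrite j v =>
    obtain ⟨hpc, rfl⟩ := hs
    have W := hI.w j
    refine ⟨writer_local hI ?_, rf⟩
    have h1 := W.own
    constructor <;> first | exact W.mok | exact W.mle | simp | skip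
    simpa [hpc] using h1
  | respWrite j =>
    obtain ⟨hpc, rfl⟩ := hs
    have W := hI.w j
    refine ⟨writer_local hI ?_, rf⟩
    have h1 := W.own
    constructor <;> first | exact W.mok | exact W.mle | simp | skip
    simpa [hpc] using h1
  | invAudit a =>
    obtain ⟨hpc, rfl⟩ := hs
    exact ⟨inv_upA hI _ _, rf⟩
  | respAudit a A =>
    obtain ⟨hpc, -, rfl⟩ := hs
    exact ⟨inv_upA hI _ _, rf⟩
  | slrRead p x win =>
    obtain ⟨rfl, hs⟩ := hs
    cases p with
    | rdr i =>
      have R := hI.r i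
      rcases hs with ⟨hpc, rfl, rfl⟩ | ⟨hpc, rfl, rfl⟩ | ⟨hpc, rfl, rfl⟩ | ⟨hpc, rfl, rfl⟩
      · refine ⟨reader_local hI le_rfl ?_, rf⟩
        have h1 := R.settled (by simp [hpc])
        by_cases hw : hasW (c.slr (c.rst i).lsr) = true
        · constructor <;> simp only [hw, if_true] <;>
            first | exact R.lsr_ge | exact R.lsr_le | exact R.H_le | exact R.mok | exact R.own | simp [h1]
        · constructor <;> simp only [hw] <;>
            first | exact R.lsr_ge | exact R.lsr_le | exact R.H_le | exact R.mok | exact R.own | simp [h1]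
      · refine ⟨reader_local hI le_rfl ?_, rf⟩
        have h1 := R.settled (by simp [hpc])
        constructor <;>
          first | exact R.lsr_ge | exact R.lsr_le | exact R.H_le | exact R.mok | exact R.own | simp [h1]
      · refine ⟨reader_local hI le_rfl ?_, rf⟩
        have h1 := R.rown hpc
        have h2 := R.itpos (by simp [hpc])
        have h3 := R.mceq (by simp [hpc])
        constructor <;>
          first | exact R.lsr_ge | exact R.lsr_le | exact R.H_le | exact R.mok | exact R.own | simp [h1, h2, h3]
      · refine ⟨reader_local hI le_rfl ?_, rf⟩
        have h1 := R.wown (by simp [hpc])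
        have h2 := R.itpos (by simp [hpc])
        have h3 := R.mceq (by simp [hpc])
        have h4 := R.wpre (by simp [hpc])
        constructor <;>
          first | exact R.lsr_ge | exact R.lsr_le | exact R.H_le | exact R.mok | exact R.own | simp [h1, h2, h3, h4]
    | wtr j =>
      have W := hI.w j
      rcases hs with ⟨hpc, rfl, hk, rfl⟩ | ⟨hpc, rfl, rfl⟩ | ⟨hpc, rfl, rfl⟩
      · refine ⟨writer_local hI ?_, rf⟩
        have h1 := W.own
        have h2 := W.fresh (by simp [hpc])
        have h3 := W.help (by simp [hpc])
        have h4 := W.scan hpc hk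
        constructor <;> first | exact W.mok | exact W.mle | simp | skip
        · simpa [hpc] using h1
        · exact h2
        · intro i hi
          split at hi
          · exact h3 i hi
          · rw [Finset.mem_insert] at hi
            rcases hi with rfl | hi
            · refine ⟨W.mok.has, (c.wst j).a, ?_, h4.2, ?_⟩
              · have := W.mok.rlo ⟨(c.wst j).k, hk⟩; omega
              · intro y h0 hy hr
                have := W.mok.rmax y h0 hy _ hr
                omega
            · exact h3 i hi
      · refine ⟨writer_local hI ?_, rf⟩
        have h1 := W.own
        have h2 := W.pR hpc
        constructor <;> first | exact W.mok | exact W.mle | simp [h2] | skip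
        simpa [hpc] using h1
      · refine ⟨writer_local hI ?_, rf⟩
        have h1 := W.own
        have h2 := W.pV (by simp [hpc])
        constructor <;> first | exact W.mok | exact W.mle | simp [h2] | skip
        simpa [hpc] using h1
    | adt a =>
      rcases hs with ⟨hpc, rfl, rfl⟩ | ⟨hpc, rfl, rfl⟩ <;> exact ⟨inv_upA hI _ _, rf⟩
  | slrWrite p x e =>
    cases p with
    | rdr i =>
      obtain ⟨hpc, rfl, rfl, rfl⟩ := hs
      have R := hI.r i
      have h1 := R.fresh (by simp [hpc])
      have h2 := R.itpos (by simp [hpc])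
      have h3 := R.mceq (by simp [hpc])
      have hnd := nodup_r (hI.nd (c.rst i).lsr) (fun h => lt_irrefl _ (h1 _ h))
      rw [slide_eq hnd]
      have he := upd_prefix c.slr (c.rst i).lsr (.r i)
      refine ⟨reader_step hI he ?_ ?_ (hI.mok.ext he) le_rfl (fun _ _ => rfl) le_rfl ?_, he⟩
      · intro x e hx
        exact (upd_mem hx).imp id And.right
      · intro x
        rcases eq_or_ne x (c.rst i).lsr with rfl | hx
        · simpa using hnd
        · simpa [hx] using hI.nd x
      · constructor <;>
          first | exact R.lsr_ge | exact R.lsr_le | exact R.H_le | exact R.mok.ext he | simp [h2, h3] | skip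
        intro x hx
        rcases upd_mem hx with hx | hx
        · exact R.own x hx
        · exact hx.1.le
    | wtr j =>
      obtain ⟨hpc, rfl, rfl, rfl⟩ := hs
      have W := hI.w j
      have h1 := W.fresh (by simp [hpc])
      have h2 := W.help (by simp [hpc])
      have hnd := nodup_w (v := (c.wst j).v) (hs := (c.wst j).toHelp) (hI.nd (c.wst j).mc.widx)
        (fun v h hh => lt_irrefl _ (h1 _ v h hh))
      rw [slide_eq hnd]
      have he := upd_prefix c.slr (c.wst j).mc.widx (.w j (c.wst j).v (c.wst j).toHelp)
      refine ⟨writer_step hI he ?_ ?_ (hI.mok.ext he) le_rfl ?_, he⟩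
      · intro x e hx
        rcases upd_mem hx with hx | ⟨rfl, rfl⟩
        · exact Or.inl hx
        · exact Or.inr ⟨_, _, rfl, h2⟩
      · intro x
        rcases eq_or_ne x (c.wst j).mc.widx with rfl | hx
        · simpa using hnd
        · simpa [hx] using hI.nd x
      · constructor <;>
          first | exact W.mok.ext he | exact W.mle | simp | skip
        · intro x v h hx
          rcases upd_mem hx with hx | hx
          · left; exact (h1 _ _ _ hx).trans_le W.mle
          · right; exact hx.1
        · exact hasW_of_mem (j := j) (v := (c.wst j).v) (h := (c.wst j).toHelp) (by simp)
    | adt a => exact hs.elim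
  | mRead p v =>
    obtain ⟨rfl, hs⟩ := hs
    cases p with
    | rdr i =>
      have R := hI.r i
      have hle := R.lsr_le
      rcases hs with ⟨hpc, rfl⟩ | ⟨hpc, rfl⟩
      · refine ⟨reader_local hI le_rfl ?_, rf⟩
        have h1 := R.settled (by simp [hpc])
        have h2 := R.wpre (by simp [hpc])
        have h3 := R.whas (by simp [hpc])
        by_cases hw : c.M.widx = (c.rst i).lsr
        · constructor <;> simp only [if_pos hw] <;>
            first | exact R.lsr_ge | exact R.lsr_le | exact R.H_le | exact hI.mok | exact R.own | simp [h1, h2, h3, hw]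
        · constructor <;> simp only [if_neg hw] <;>
            first | exact R.lsr_ge | exact R.lsr_le | exact R.H_le | exact hI.mok | exact R.own | simp [h1, h2, h3] | skip
          omega
      · have h1 := R.loop hpc
        have h2 := R.lsr_ge
        have h3 := R.H_le
        have h4 := R.own
        split
        · rename_i hlt
          have h5 := hI.mok.rhi i
          have h6 := hI.mok.rin i (by omega)
          refine ⟨reader_local hI hlt.le ?_, rf⟩
          constructor <;> first | exact hI.mok | simp [h6] | skip
          · omega
          · omega
          · omega
          · intro x hx; have := h4 x hx; omega
        · refine ⟨reader_local hI h1.le ?_, rf⟩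
          have h5 := hI.mok.w0
          constructor <;> first | exact hI.mok | simp | skip
          · omega
          · omega
          · intro x hx; have := h4 x hx; omega
          · intro x hx; have := h4 x hx; omega
    | wtr j =>
      obtain ⟨hpc, rfl⟩ := hs
      have W := hI.w j
      have h1 := W.own
      refine ⟨writer_local hI ?_, rf⟩
      have h2 : ∀ x v h, Entry.w j v h ∈ c.slr x → x < c.M.widx := by simpa [hpc] using h1
      constructor <;> first | exact hI.mok | exact le_rfl | simp | skip
      · exact h2
      · exact h2
    | adt a =>
      obtain ⟨hpc, rfl⟩ := hs
      exact ⟨inv_upA hI _ _, rf⟩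
  | mWrite p v =>
    cases p with
    | rdr i =>
      have R := hI.r i
      rcases hs with ⟨hpc, rfl, rfl⟩ | ⟨hpc, hw, rfl, rfl⟩
      · have h1 := R.settled (by simp [hpc])
        have h2 := R.wpre (by simp [hpc])
        have h3 := R.whas (by simp [hpc])
        have h4 := R.mceq (by simp [hpc])
        have hv := R.mok.mArg h4 h2 h3 (c.rst i).lval
        have hle := (wmax_le c.M (mArg (c.rst i).mc (c.rst i).win (c.rst i).lsr (c.rst i).lval)).2
        simp only [mArg] at hle
        refine ⟨reader_M hI hv le_rfl ?_, rf⟩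
        constructor <;>
            first | exact R.lsr_ge | exact R.H_le | exact R.mok | exact R.own | simp [h1] | skip
        · simp only [mArg]; omega
        · simp only [mArg]; omega
      · have h2 := R.wpre (by simp [hpc])
        have h4 := R.mceq (by simp [hpc])
        have h5 := R.wown (by simp [hpc])
        have h6 := R.itpos (by simp [hpc])
        have hv := R.mok.mArg h4 h2 hw (c.rst i).lval
        have hle := (wmax_le c.M (mArg (c.rst i).mc (c.rst i).win (c.rst i).lsr (c.rst i).lval)).2
        simp only [mArg] at hle
        refine ⟨reader_M hI hv le_rfl ?_, rf⟩
        constructor <;>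
            first | exact R.lsr_ge | exact R.H_le | exact R.mok | exact R.own | simp [h2, h4, h5, h6] | skip
        · simp only [mArg]; omega
        · intro _; simp only [mArg]; omega
    | wtr j =>
      obtain ⟨hpc, rfl, rfl⟩ := hs
      have W := hI.w j
      have h1 := W.own
      have h2 := W.pV (by simp [hpc])
      have h3 := W.mle
      have hv := W.mok.mArg rfl h2.1 h2.2 (c.wst j).val
      have hle := wmax_le c.M (mArg (c.wst j).mc (c.wst j).win (c.wst j).mc.widx (c.wst j).val)
      refine ⟨writer_step hI rf (fun _ _ h => Or.inl h) hI.nd (hI.mok.wmax hv) hle.1 ?_, rf⟩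
      have hle2 := hle.2
      have e : (mArg (c.wst j).mc (c.wst j).win (c.wst j).mc.widx (c.wst j).val).widx
        = (c.wst j).mc.widx + 1 := rfl
      constructor <;> first | exact W.mok | exact W.mle.trans hle.1 | simp | skip
      intro x v h hx
      rcases h1 x v h hx with h | ⟨-, h⟩ <;> omega
    | adt a => exact hs.elim
  | hRead j k a =>
    obtain ⟨hpc, hk, rfl, rfl⟩ := hs
    have W := hI.w j
    have h1 := W.own
    have h2 := W.fresh (by simp [hpc])
    have h3 := W.help (by simp [hpc])
    refine ⟨writer_local hI ?_, rf⟩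
    split
    · rename_i hlt
      constructor <;> first | exact W.mok | exact W.mle | simp | skip
      · simpa [hpc] using h1
      · exact h2
      · exact h3
      · intro hk'
        have : (⟨(c.wst j).k, hk'⟩ : Fin m) = k := Fin.ext hk.symm
        rw [this]
        exact ⟨hlt, (hI.r k).H_le⟩
    · constructor <;> first | exact W.mok | exact W.mle | simp [hpc] | skip
      · simpa [hpc] using h1
      · exact h2
      · exact h3
  | hWrite i x =>
    obtain ⟨hpc, rfl, rfl⟩ := hs
    have R := hI.r i
    have h1 := R.fresh (by simp [hpc])
    have h2 := R.itpos (by simp [hpc])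
    have h3 := R.mceq (by simp [hpc])
    refine ⟨reader_step hI rf (fun _ _ h => Or.inl h) hI.nd hI.mok le_rfl ?_ le_rfl ?_, rf⟩
    · intro k hk
      simp [hk]
    · constructor <;>
        first | exact R.lsr_ge | exact R.lsr_le | exact R.mok | exact R.own | simp [h2, h3] | skip
      exact h1
  | tau p =>
    cases p with
    | rdr i =>
      have R := hI.r i
      rcases hs with ⟨hpc, hw, rfl⟩ | ⟨hpc, rfl⟩
      · have h2 := R.wpre (by simp [hpc])
        have h4 := R.mceq (by simp [hpc])
        have h5 := R.wown (by simp [hpc])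
        have h6 := R.itpos (by simp [hpc])
        refine ⟨reader_local hI le_rfl ?_, rf⟩
        constructor <;>
          first | exact R.lsr_ge | exact R.lsr_le | exact R.H_le | exact R.mok | exact R.own | simp [h2, h4, h5, h6, hw]
      · have h2 := R.wpre (by simp [hpc])
        have h5 := R.wown (by simp [hpc])
        have h6 := R.itpos (by simp [hpc])
        have h7 := R.fin hpc
        refine ⟨reader_local hI le_rfl ?_, rf⟩
        by_cases hi : i ∈ readersOf (c.rst i).win
        · have h8 := readersOf_mono h2 hi
          constructor <;> simp only [if_pos hi] <;>
            first | exact R.lsr_ge | exact R.lsr_le | exact R.H_le | exact R.mok | exact R.own | simp [h8]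
        · have h8 : hasW (c.rst i).win = true := by
            by_contra hc
            exact hi (mem_readersOf_of_noW h5 (by simpa using hc))
          have h9 := h7 h8
          constructor <;> simp only [if_neg hi] <;>
            first | exact R.lsr_ge | exact R.lsr_le | exact R.H_le | exact R.mok | exact R.own | simp [h6, h9]
    | wtr j =>
      obtain ⟨hpc, -, rfl⟩ := hs
      have W := hI.w j
      have h1 := W.own
      have h2 := W.fresh (by simp [hpc])
      have h3 := W.help (by simp [hpc])
      refine ⟨writer_local hI ?_, rf⟩
      constructor <;> first | exact W.mok | exact W.mle | simp | skip
      · simpa [hpc] using h1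
      · exact h2
      · exact h3
    | adt a => exact hs.elim

theorem inv_exec (E : Exec m n v0 j0) (t : ℕ) (ht : t ≤ E.len) : Inv (E.cfg t) := by
  induction t with
  | zero => rw [E.h0]; exact inv_start m n v0 j0
  | succ t ih => exact (inv_step (ih (by omega)) (E.hstep t (by omega))).1

theorem slr_mono (E : Exec m n v0 j0) {s t : ℕ} (hst : s ≤ t) (ht : t ≤ E.len) (x : ℤ) :
    (E.cfg s).slr x <+: (E.cfg t).slr x := by
  induction t, hst using Nat.le_induction with
  | base => exact List.prefix_rfl
  | succ t hst ih =>
    exact (ih (by omega)).trans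
      ((inv_step (inv_exec E t (by omega)) (E.hstep t (by omega))).2 x)

/-- Phase of a READ invoked with `lsr = x₀`: before the end of its first read of `M` in the loop,
    `lsr` is unchanged. -/
def Phase (x₀ : ℤ) (s : RState m n) : Prop :=
  s.pc ≠ .idle ∧ ((s.lsr = x₀ ∧ (s.pc = .precheck ∨ s.pc = .preM ∨ s.pc = .preHelp ∨
    s.pc = .retNow ∨ s.pc = .loopM)) ∨ s.it ≠ 0)

theorem phase_step {c c' : Config m n} {l : Lbl m n} {i : Fin m} {x₀ : ℤ} (hs : Step c l c')
    (hl : ∀ v, l ≠ .respRead i v) (hp : Phase x₀ (c.rst i)) : Phase x₀ (c'.rst i) := by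
  have key : ∀ (k : Fin m) (s' : RState m n), (k = i → Phase x₀ s') →
      Phase x₀ (Function.update c.rst k s' i) := by
    intro k s' h
    rcases eq_or_ne i k with rfl | hk
    · simpa using h rfl
    · simpa [hk] using hp
  cases l with
  | invRead k =>
    obtain ⟨hpc, rfl⟩ := hs
    exact key _ _ (by rintro rfl; exact absurd hpc hp.1)
  | respRead k v =>
    obtain ⟨hpc, -, rfl⟩ := hs
    exact key _ _ (by rintro rfl; exact absurd rfl (hl v))
  | invWrite j v => obtain ⟨hpc, rfl⟩ := hs; exact hp
  | respWrite j => obtain ⟨hpc, rfl⟩ := hs; exact hp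
  | invAudit a => obtain ⟨hpc, rfl⟩ := hs; exact hp
  | respAudit a A => obtain ⟨hpc, -, rfl⟩ := hs; exact hp
  | slrRead p x win =>
    obtain ⟨rfl, hs⟩ := hs
    cases p with
    | rdr k =>
      rcases hs with ⟨hpc, rfl, rfl⟩ | ⟨hpc, rfl, rfl⟩ | ⟨hpc, rfl, rfl⟩ | ⟨hpc, rfl, rfl⟩ <;>
        refine key _ _ ?_ <;> rintro rfl <;> simp only [Phase, hpc] at hp ⊢ <;> simp at hp ⊢ <;>
        first | exact hp | exact Or.inr hp | (split <;> simp [hp]) | tauto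
    | wtr j => rcases hs with ⟨hpc, rfl, hk, rfl⟩ | ⟨hpc, rfl, rfl⟩ | ⟨hpc, rfl, rfl⟩ <;> exact hp
    | adt a => rcases hs with ⟨hpc, rfl, rfl⟩ | ⟨hpc, rfl, rfl⟩ <;> exact hp
  | slrWrite p x e =>
    cases p with
    | rdr k =>
      obtain ⟨hpc, rfl, rfl, rfl⟩ := hs
      refine key _ _ ?_
      rintro rfl; simp only [Phase, hpc] at hp ⊢; simp at hp ⊢; exact hp
    | wtr j => obtain ⟨hpc, rfl, rfl, rfl⟩ := hs; exact hp
    | adt a => exact hs.elim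
  | mRead p v =>
    obtain ⟨rfl, hs⟩ := hs
    cases p with
    | rdr k =>
      rcases hs with ⟨hpc, rfl⟩ | ⟨hpc, rfl⟩
      · refine key _ _ ?_
        rintro rfl; simp only [Phase, hpc] at hp ⊢; simp at hp ⊢; split <;> simp <;> tauto
      · refine key _ _ ?_
        rintro rfl; simp only [Phase]; split <;> simp
    | wtr j => obtain ⟨hpc, rfl⟩ := hs; exact hp
    | adt a => obtain ⟨hpc, rfl⟩ := hs; exact hp
  | mWrite p v =>
    cases p with
    | rdr k =>
      rcases hs with ⟨hpc, rfl, rfl⟩ | ⟨hpc, hw, rfl, rfl⟩ <;> refine key _ _ ?_ <;> rintro rfl <;>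
        simp only [Phase, hpc] at hp ⊢ <;> simp at hp ⊢ <;> exact hp
    | wtr j => obtain ⟨hpc, rfl, rfl⟩ := hs; exact hp
    | adt a => exact hs.elim
  | hRead j k a => obtain ⟨hpc, hk, rfl, rfl⟩ := hs; exact hp
  | hWrite k x =>
    obtain ⟨hpc, rfl, rfl⟩ := hs
    refine key _ _ ?_
    rintro rfl; simp only [Phase, hpc] at hp ⊢; simp at hp ⊢; exact hp
  | tau p =>
    cases p with
    | rdr k =>
      rcases hs with ⟨hpc, hw, rfl⟩ | ⟨hpc, rfl⟩ <;> refine key _ _ ?_ <;> rintro rfl <;>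
        simp only [Phase, hpc] at hp ⊢ <;> simp at hp ⊢ <;>
        first | exact hp | exact Or.inr hp | (split <;> simp [hp]) | tauto
    | wtr j => obtain ⟨hpc, -, rfl⟩ := hs; exact hp
    | adt a => exact hs.elim

/-- Lemma `no_help_before_calling`.  Consider a READ
operation by reader `p_i` that starts (invocation at step `tinv`) with local
variable `lsr = x₀` and, in the first iteration of its repeat loop (the
iteration counter is `0`), reads the triple `mv` (hence `x₁ = mv.widx`) from
`M` at step `t₁` of the same operation.  Then for every index `x` with
`x₀ < x < x₁` and every sequence `win` held in `SLR[x]` at any point,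
`i ∉ READERS(win)`; in particular the READ has not received help in any such
sliding register (`i` is in no helping set of the first `w`-tuple). -/
theorem no_help_before_calling (m n : ℕ) (v0 : Val) (j0 : Fin n)
    (E : Exec m n v0 j0) (i : Fin m) (tinv t₁ : ℕ) (x₀ : ℤ) (mv : MVal m)
    (hinv : tinv < E.len) (hinvl : E.lbl tinv = .invRead i)
    (hx₀ : ((E.cfg tinv).rst i).lsr = x₀)
    (h₁ : tinv < t₁) (h₂ : t₁ < E.len)
    (hl : E.lbl t₁ = .mRead (.rdr i) mv)
    (hpc : ((E.cfg t₁).rst i).pc = .loopM)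
    (hfirst : ((E.cfg t₁).rst i).it = 0)
    (hsameop : ∀ t, tinv < t → t < t₁ → ∀ v, E.lbl t ≠ .respRead i v) :
    (∀ x : ℤ, x₀ < x → x < mv.widx →
        ∀ t, t ≤ E.len → i ∉ readersOf ((E.cfg t).slr x)) ∧
    (∀ x : ℤ, x₀ < x → x < mv.widx → ∀ t, t ≤ E.len →
        ∀ j v h, firstW ((E.cfg t).slr x) = some (j, v, h) → i ∉ h) := by
  have ph : ∀ t, tinv + 1 ≤ t → t ≤ t₁ → Phase x₀ ((E.cfg t).rst i) := by
    intro t ht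
    induction t, ht using Nat.le_induction with
    | base =>
      intro _
      have hs := E.hstep tinv hinv
      rw [hinvl] at hs
      obtain ⟨hp, hc⟩ := hs
      rw [hc]
      simp only [upR, Function.update_self, Phase]
      split <;> simp [hx₀]
    | succ t ht ih =>
      intro h
      exact phase_step (E.hstep t (by omega)) (hsameop t (by omega) (by omega)) (ih (by omega))
  have hlsr : ((E.cfg t₁).rst i).lsr = x₀ := by
    have h := (ph t₁ h₁ le_rfl).2
    rw [hfirst] at h
    simpa [hpc] using h
  have hmv : mv = (E.cfg t₁).M := by
    have hs := E.hstep t₁ h₂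
    rw [hl] at hs
    exact hs.1
  have hI := inv_exec E t₁ h₂.le
  have R := hI.r i
  have hge := R.lsr_ge
  have hset := R.settled (by simp [hpc, hfirst])
  rw [hlsr] at hset hge
  have now : ∀ x : ℤ, x₀ < x → i ∉ readersOf ((E.cfg t₁).slr x) := by
    intro x hx hi
    rcases mem_of_mem_readersOf hi with h | ⟨j, v, h, hm, hh⟩
    · have := R.own x h; omega
    · obtain ⟨-, a, ha0, hal, hmax⟩ := hI.hp x j v h hm i hh
      rw [hlsr] at hal
      rcases hset with h0 | h0
      · omega
      · have := hmax x₀ (by omega) hx h0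
        omega
  have main : ∀ x : ℤ, x₀ < x → x < mv.widx →
      ∀ t, t ≤ E.len → i ∉ readersOf ((E.cfg t).slr x) := by
    intro x hx hx1 t ht hi
    rw [hmv] at hx1
    refine now x hx ?_
    rcases le_total t t₁ with h | h
    · exact readersOf_mono (slr_mono E h h₂.le x) hi
    · rwa [readersOf_fix (slr_mono E h ht x) (hI.mok.has x (by omega) hx1)] at hi
  refine ⟨main, ?_⟩
  intro x hx hx1 t ht j v h hf hi
  refine main x hx hx1 t ht ?_
  rw [readersOf, hf]
  simp [hi]

end Alg1
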